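/- The function u(x,t) = −2 Bᵀ e^{−Aᵀx} Γ(x,t)⁻¹ e^{−Aᵀx} e^{8(Aᵀ)³t} Cᵀ has partial derivative with respect to x given by u_x(x,t) = 4 Bᵀ e^{−Aᵀx} Γ(x,t)⁻¹ (Aᵀ − 𝒬(x,t) A 𝒩(x)) Γ(x,t)⁻¹ e^{−Aᵀx} e^{8(Aᵀ)³t} Cᵀ. -/

import Mathlib

open Matrix MeasureTheory Filter

noncomputable def mexp {p : ℕ} (M : Matrix (Fin p) (Fin p) ℝ) : Matrix (Fin p) (Fin p) ℝ :=
  ∑' k : ℕ, (k.factorial : ℝ)⁻¹ • M ^ k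

def EigPos {p : ℕ} (A : Matrix (Fin p) (Fin p) ℝ) : Prop :=
  ∀ μ ∈ spectrum ℂ (A.map Complex.ofReal), 0 < μ.re

def Observable {p : ℕ} (A : Matrix (Fin p) (Fin p) ℝ) (C : Matrix (Fin 1) (Fin p) ℝ) : Prop :=
  ∀ v : Fin p → ℝ, (∀ r : ℕ, (C * A ^ r) *ᵥ v = 0) → v = 0

def Controllable {p : ℕ} (A : Matrix (Fin p) (Fin p) ℝ) (B : Matrix (Fin p) (Fin 1) ℝ) : Prop :=
  ∀ v : Fin p → ℝ, (∀ r : ℕ, (Bᵀ * Aᵀ ^ r) *ᵥ v = 0) → v = 0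

noncomputable def Qmat {p : ℕ} (A : Matrix (Fin p) (Fin p) ℝ) (C : Matrix (Fin 1) (Fin p) ℝ) :
    Matrix (Fin p) (Fin p) ℝ :=
  Matrix.of fun i j =>
    ∫ s in Set.Ioi (0 : ℝ), (mexp (-(s • Aᵀ)) * (Cᵀ * C) * mexp (-(s • A))) i j

noncomputable def Nmat {p : ℕ} (A : Matrix (Fin p) (Fin p) ℝ) (B : Matrix (Fin p) (Fin 1) ℝ) :
    Matrix (Fin p) (Fin p) ℝ :=
  Matrix.of fun i j =>
    ∫ s in Set.Ioi (0 : ℝ), (mexp (-(s • A)) * (B * Bᵀ) * mexp (-(s • Aᵀ))) i j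

noncomputable def Pmat {p : ℕ} (A : Matrix (Fin p) (Fin p) ℝ) (B : Matrix (Fin p) (Fin 1) ℝ)
    (C : Matrix (Fin 1) (Fin p) ℝ) : Matrix (Fin p) (Fin p) ℝ :=
  Matrix.of fun i j =>
    ∫ s in Set.Ioi (0 : ℝ), (mexp (-(s • A)) * (B * C) * mexp (-(s • A))) i j

noncomputable def Fmat {p : ℕ} (A : Matrix (Fin p) (Fin p) ℝ) (B : Matrix (Fin p) (Fin 1) ℝ)
    (C : Matrix (Fin 1) (Fin p) ℝ) (x t : ℝ) : Matrix (Fin p) (Fin p) ℝ :=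
  mexp ((2 * x) • Aᵀ - (8 * t) • Aᵀ ^ 3) +
    Qmat A C * mexp (-((2 * x) • A) + (8 * t) • A ^ 3) * Nmat A B

noncomputable def Emat {p : ℕ} (A : Matrix (Fin p) (Fin p) ℝ) (B : Matrix (Fin p) (Fin 1) ℝ)
    (C : Matrix (Fin 1) (Fin p) ℝ) (x t : ℝ) : Matrix (Fin p) (Fin p) ℝ :=
  mexp ((2 * x) • A - (8 * t) • A ^ 3) +
    Pmat A B C * mexp (-((2 * x) • A) + (8 * t) • A ^ 3) * Pmat A B C

noncomputable def uFun {p : ℕ} (A : Matrix (Fin p) (Fin p) ℝ) (B : Matrix (Fin p) (Fin 1) ℝ)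
    (C : Matrix (Fin 1) (Fin p) ℝ) (x t : ℝ) : ℝ :=
  -2 * ((Bᵀ * (Fmat A B C x t)⁻¹ * Cᵀ : Matrix (Fin 1) (Fin 1) ℝ) 0 0)

noncomputable def vFun {p : ℕ} (A : Matrix (Fin p) (Fin p) ℝ) (B : Matrix (Fin p) (Fin 1) ℝ)
    (C : Matrix (Fin 1) (Fin p) ℝ) (x t : ℝ) : ℝ :=
  -2 * ((C * (Emat A B C x t)⁻¹ * B : Matrix (Fin 1) (Fin 1) ℝ) 0 0)

noncomputable def calQ {p : ℕ} (A : Matrix (Fin p) (Fin p) ℝ) (C : Matrix (Fin 1) (Fin p) ℝ)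
    (x t : ℝ) : Matrix (Fin p) (Fin p) ℝ :=
  mexp (-(x • Aᵀ)) * mexp ((8 * t) • Aᵀ ^ 3) * Qmat A C * mexp (-(x • A)) * mexp ((8 * t) • A ^ 3)

noncomputable def calN {p : ℕ} (A : Matrix (Fin p) (Fin p) ℝ) (B : Matrix (Fin p) (Fin 1) ℝ)
    (x : ℝ) : Matrix (Fin p) (Fin p) ℝ :=
  mexp (-(x • A)) * Nmat A B * mexp (-(x • Aᵀ))

noncomputable def Gam {p : ℕ} (A : Matrix (Fin p) (Fin p) ℝ) (B : Matrix (Fin p) (Fin 1) ℝ)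
    (C : Matrix (Fin 1) (Fin p) ℝ) (x t : ℝ) : Matrix (Fin p) (Fin p) ℝ :=
  1 + calQ A C x t * calN A B x

noncomputable def Om {p : ℕ} (A : Matrix (Fin p) (Fin p) ℝ) (B : Matrix (Fin p) (Fin 1) ℝ)
    (C : Matrix (Fin 1) (Fin p) ℝ) (w t : ℝ) : ℝ :=
  ((C * mexp (-(w • A)) * mexp ((8 * t) • A ^ 3) * B : Matrix (Fin 1) (Fin 1) ℝ) 0 0)

noncomputable def Kker {p : ℕ} (A : Matrix (Fin p) (Fin p) ℝ) (B : Matrix (Fin p) (Fin 1) ℝ)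
    (C : Matrix (Fin 1) (Fin p) ℝ) (x y t : ℝ) : ℝ :=
  ((Bᵀ * (Fmat A B C x t)⁻¹ * mexp (-((y - x) • Aᵀ)) * Cᵀ : Matrix (Fin 1) (Fin 1) ℝ) 0 0)


theorem mexp_eq {p : ℕ} (M : Matrix (Fin p) (Fin p) ℝ) : mexp M = NormedSpace.exp M := by
  rw [NormedSpace.exp_eq_tsum ℝ]; rfl

section aux
open scoped Matrix.Norms.Operator

theorem exp_gen {p : ℕ} (M D : Matrix (Fin p) (Fin p) ℂ) (l : ℂ) (hD : D = M - l • 1)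
    (v : Fin p → ℂ) (k : ℕ) (hk : D ^ k *ᵥ v = 0) (s : ℂ) :
    NormedSpace.exp (-(s • M)) *ᵥ v =
      ∑ n ∈ Finset.range k, (Complex.exp (-(s * l)) * ((n.factorial : ℂ)⁻¹ * (-s) ^ n)) • (D ^ n *ᵥ v) := by
  have h1 : -(s • M) = algebraMap ℂ (Matrix (Fin p) (Fin p) ℂ) (-(s * l)) + (-s) • D := by
    rw [hD, Algebra.algebraMap_eq_smul_one]; module
  have h2 : NormedSpace.exp (-(s • M)) = Complex.exp (-(s * l)) • NormedSpace.exp ((-s) • D) := by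
    have h0 : NormedSpace.exp (algebraMap ℂ (Matrix (Fin p) (Fin p) ℂ) (-(s * l))) =
        algebraMap ℂ (Matrix (Fin p) (Fin p) ℂ) (NormedSpace.exp (-(s * l))) :=
      (NormedSpace.algebraMap_exp_comm _).symm
    rw [h1, Matrix.exp_add_of_commute _ _ (Algebra.commute_algebraMap_left _ _), h0,
      ← Complex.exp_eq_exp_ℂ, Algebra.algebraMap_eq_smul_one, smul_mul_assoc, one_mul]
  have h3 := NormedSpace.exp_series_hasSum_exp' (𝕂 := ℂ) ((-s) • D)
  let L : Matrix (Fin p) (Fin p) ℂ →ₗ[ℂ] (Fin p → ℂ) :=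
    { toFun := fun X => X *ᵥ v
      map_add' := fun X Y => Matrix.add_mulVec X Y v
      map_smul' := fun c X => Matrix.smul_mulVec c X v }
  have hL : Continuous L := L.continuous_of_finiteDimensional
  have h4 := h3.map L hL
  have h5 : NormedSpace.exp ((-s) • D) *ᵥ v =
      ∑ n ∈ Finset.range k, ((n.factorial : ℂ)⁻¹ * (-s) ^ n) • (D ^ n *ᵥ v) := by
    refine h4.unique ?_
    have : (L ∘ fun n : ℕ => ((n.factorial : ℂ)⁻¹) • ((-s) • D) ^ n) =
        fun n : ℕ => ((n.factorial : ℂ)⁻¹ * (-s) ^ n) • (D ^ n *ᵥ v) := by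
      funext n
      simp only [L, Function.comp, LinearMap.coe_mk, AddHom.coe_mk, smul_pow, Matrix.smul_mulVec,
        smul_smul]
    rw [this]
    refine hasSum_sum_of_ne_finset_zero fun n hn => ?_
    have hn' : k ≤ n := by simpa using hn
    have : D ^ n *ᵥ v = 0 := by
      rw [← Nat.sub_add_cancel hn', pow_add, ← Matrix.mulVec_mulVec, hk, Matrix.mulVec_zero]
    rw [this, smul_zero]
  rw [h2, Matrix.smul_mulVec, h5, Finset.smul_sum]
  simp only [smul_smul]

theorem memLp_term (l : ℂ) (hl : 0 < l.re) (n : ℕ) :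
    MemLp (fun s : ℝ => Complex.exp (-((s : ℂ) * l)) * (((n.factorial : ℂ)⁻¹) * (-(s : ℂ)) ^ n)) 2
      (volume.restrict (Set.Ioi 0)) := by
  rw [memLp_two_iff_integrable_sq_norm (by fun_prop)]
  have h := (integrableOn_rpow_mul_exp_neg_mul_rpow (p := 1) (s := ((2 * n : ℕ) : ℝ)) (b := 2 * l.re)
    (by have : (0:ℝ) ≤ ((2 * n : ℕ) : ℝ) := Nat.cast_nonneg _
        linarith) one_pos (by positivity)).const_mul (((n.factorial : ℝ)⁻¹) ^ 2)
  refine h.congr (Filter.Eventually.of_forall fun s => ?_)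
  simp only [Real.rpow_natCast, Real.rpow_one, norm_mul, Complex.norm_exp, norm_pow, norm_inv, norm_neg,
    Complex.norm_natCast, Complex.norm_real, Real.norm_eq_abs]
  rw [mul_pow, mul_pow, ← Real.exp_nat_mul, ← pow_mul, mul_comm n 2, pow_mul |s|, sq_abs, ← pow_mul]
  have : ((2:ℕ):ℝ) * (-((s:ℂ) * l)).re = -(2 * l.re) * s := by simp; ring
  rw [this]; ring

theorem memLp_exp {p : ℕ} (A : Matrix (Fin p) (Fin p) ℝ) (hA : EigPos A) (i j : Fin p) :
    MemLp (fun s : ℝ => mexp (-(s • A)) i j) 2 (volume.restrict (Set.Ioi 0)) := by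
  set M : Matrix (Fin p) (Fin p) ℂ := A.map Complex.ofReal with hM
  let W : Submodule ℂ (Fin p → ℂ) :=
    { carrier := {v | ∀ i, MemLp (fun s : ℝ => (NormedSpace.exp (-((s : ℂ) • M)) *ᵥ v) i) 2
        (volume.restrict (Set.Ioi 0))}
      add_mem' := fun {v w} hv hw i => by
        simp only [Matrix.mulVec_add, Pi.add_apply]
        exact (hv i).add (hw i)
      zero_mem' := fun i => by
        simp only [Matrix.mulVec_zero, Pi.zero_apply]
        exact MemLp.zero'
      smul_mem' := fun c v hv i => by
        simp only [Matrix.mulVec_smul, Pi.smul_apply]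
        exact (hv i).const_smul c }
  have hW : W = ⊤ := by
    rw [eq_top_iff, ← Module.End.iSup_maxGenEigenspace_eq_top (Matrix.toLin' M)]
    refine iSup_le fun l => ?_
    by_cases hl : l ∈ spectrum ℂ M
    · have hl' := hA l hl
      intro v hv
      obtain ⟨k, hk⟩ := (Module.End.mem_maxGenEigenspace _ _ _).1 hv
      have hk' : (M - l • 1) ^ k *ᵥ v = 0 := by
        rw [← Matrix.toLin'_apply, Matrix.toLin'_pow, map_sub, map_smul, Matrix.toLin'_one]
        exact hk
      intro i
      simp only [exp_gen M _ l rfl v k hk', Finset.sum_apply, Pi.smul_apply, smul_eq_mul]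
      exact memLp_finsetSum _ fun n _ => (memLp_term l hl' n).mul_const _
    · have : Module.End.maxGenEigenspace (Matrix.toLin' M) l = ⊥ := by
        by_contra h
        apply hl
        rw [← Matrix.spectrum_toLin', ← Module.End.hasEigenvalue_iff_mem_spectrum]
        exact Module.End.HasUnifEigenvalue.lt (k := ⊤) zero_lt_one h
      rw [this]; exact bot_le
  have hj : (Pi.single j 1 : Fin p → ℂ) ∈ W := hW ▸ Submodule.mem_top
  have := (hj i).re
  refine (memLp_congr_ae (Filter.Eventually.of_forall fun s => ?_)).1 this
  have hs : NormedSpace.exp (-((s : ℂ) • M)) = (NormedSpace.exp (-(s • A))).map Complex.ofReal := by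
    have h := NormedSpace.map_exp (Complex.ofRealHom.mapMatrix (m := Fin p))
      (by exact continuous_id.matrix_map Complex.continuous_ofReal) (-(s • A))
    have h2 : (Complex.ofRealHom.mapMatrix (m := Fin p)) (-(s • A)) = -((s : ℂ) • M) := by
      ext a b; simp [hM]
    rw [h2] at h
    exact h.symm
  rw [hs]
  simp [mexp_eq]

theorem psd_gram {p : ℕ} (μ : Measure ℝ) (f : Fin p → ℝ → ℝ) (hf : ∀ i, MemLp (f i) 2 μ)
    (M : Matrix (Fin p) (Fin p) ℝ) (hM : ∀ i j, M i j = ∫ s, f i s * f j s ∂μ) :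
    M.PosSemidef := by
  have hint : ∀ i j, Integrable (fun s => f i s * f j s) μ := fun i j => (hf i).integrable_mul (hf j)
  refine Matrix.PosSemidef.of_dotProduct_mulVec_nonneg ?_ fun v => ?_
  · ext i j
    simp only [Matrix.conjTranspose_apply, star_trivial, hM, mul_comm]
  · have : star v ⬝ᵥ M *ᵥ v = ∫ s, (∑ i, v i * f i s) ^ 2 ∂μ := by
      have e : ∀ s, (∑ i, v i * f i s) ^ 2 = ∑ i, ∑ j, (v i * v j) * (f i s * f j s) := by
        intro s
        rw [sq, Finset.sum_mul_sum]
        refine Finset.sum_congr rfl fun i _ => Finset.sum_congr rfl fun j _ => by ring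
      simp only [e]
      rw [integral_finsetSum _ fun i _ => integrable_finsetSum _ fun j _ => (hint i j).const_mul _]
      simp only [dotProduct, Matrix.mulVec, star_trivial, Finset.mul_sum]
      refine Finset.sum_congr rfl fun i _ => ?_
      rw [integral_finsetSum _ fun j _ => (hint i j).const_mul _]
      refine Finset.sum_congr rfl fun j _ => ?_
      rw [integral_const_mul, hM]; ring
    rw [this]
    exact integral_nonneg fun s => sq_nonneg _

theorem mexp_transpose {p : ℕ} (M : Matrix (Fin p) (Fin p) ℝ) : mexp Mᵀ = (mexp M)ᵀ := by
  rw [mexp_eq, mexp_eq, Matrix.exp_transpose]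

theorem Qmat_psd {p : ℕ} (A : Matrix (Fin p) (Fin p) ℝ) (C : Matrix (Fin 1) (Fin p) ℝ)
    (hA : EigPos A) : (Qmat A C).PosSemidef := by
  refine psd_gram (volume.restrict (Set.Ioi 0)) (fun i s => (C * mexp (-(s • A))) 0 i) (fun i => ?_) _ fun i j => ?_
  · simp only [Matrix.mul_apply]
    exact memLp_finsetSum _ fun k _ => (memLp_exp A hA k i).const_mul _
  · simp only [Qmat, Matrix.of_apply]
    congr 1
    funext s
    have : mexp (-(s • Aᵀ)) * (Cᵀ * C) * mexp (-(s • A)) =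
        (C * mexp (-(s • A)))ᵀ * (C * mexp (-(s • A))) := by
      rw [Matrix.transpose_mul, ← mexp_transpose, Matrix.transpose_neg, Matrix.transpose_smul]
      simp only [Matrix.mul_assoc]
    rw [this, Matrix.mul_apply]; simp

theorem Nmat_psd {p : ℕ} (A : Matrix (Fin p) (Fin p) ℝ) (B : Matrix (Fin p) (Fin 1) ℝ)
    (hA : EigPos A) : (Nmat A B).PosSemidef := by
  refine psd_gram (volume.restrict (Set.Ioi 0)) (fun i s => (mexp (-(s • A)) * B) i 0) (fun i => ?_) _ fun i j => ?_
  · simp only [Matrix.mul_apply]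
    exact memLp_finsetSum _ fun k _ => (memLp_exp A hA i k).mul_const _
  · simp only [Nmat, Matrix.of_apply]
    congr 1
    funext s
    have : mexp (-(s • A)) * (B * Bᵀ) * mexp (-(s • Aᵀ)) =
        (mexp (-(s • A)) * B) * (mexp (-(s • A)) * B)ᵀ := by
      rw [Matrix.transpose_mul, ← mexp_transpose, Matrix.transpose_neg, Matrix.transpose_smul]
      simp only [Matrix.mul_assoc]
    rw [this, Matrix.mul_apply]; simp

theorem det_one_add_ne {p : ℕ} (Q N : Matrix (Fin p) (Fin p) ℝ) (hQ : Q.PosSemidef)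
    (hN : N.PosSemidef) : IsUnit (1 + Q * N) := by
  rw [Matrix.isUnit_iff_isUnit_det, isUnit_iff_ne_zero]
  intro h
  obtain ⟨v, hv, h0⟩ := Matrix.exists_mulVec_eq_zero_iff.2 h
  apply hv
  rw [Matrix.add_mulVec, Matrix.one_mulVec, ← Matrix.mulVec_mulVec] at h0
  have h1 := hQ.dotProduct_mulVec_nonneg (N *ᵥ v)
  have h2 := hN.dotProduct_mulVec_nonneg v
  have h3 : star (N *ᵥ v) ⬝ᵥ v + star (N *ᵥ v) ⬝ᵥ Q *ᵥ (N *ᵥ v) = 0 := by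
    rw [← dotProduct_add, h0, dotProduct_zero]
  have h4 : star (N *ᵥ v) ⬝ᵥ v = star v ⬝ᵥ N *ᵥ v := by
    rw [star_trivial, star_trivial, dotProduct_comm]
  have h5 : N *ᵥ v = 0 := (hN.dotProduct_mulVec_zero_iff v).1 (by linarith)
  rw [h5, Matrix.mulVec_zero, add_zero] at h0
  exact h0

theorem mexp_comm {p : ℕ} (M N : Matrix (Fin p) (Fin p) ℝ) (h : Commute M N) :
    Commute (mexp M) (mexp N) := by
  rw [mexp_eq, mexp_eq]; exact Commute.exp h

theorem mexp_comm' {p : ℕ} (M N : Matrix (Fin p) (Fin p) ℝ) (h : Commute M N) :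
    Commute M (mexp N) := by
  rw [mexp_eq]; exact Commute.exp_right h

theorem Gam_unit {p : ℕ} (A : Matrix (Fin p) (Fin p) ℝ)
    (B : Matrix (Fin p) (Fin 1) ℝ) (C : Matrix (Fin 1) (Fin p) ℝ)
    (hA : EigPos A) (x t : ℝ) : IsUnit (Gam A B C x t) := by
  refine det_one_add_ne _ _ ?_ ?_
  · have := (Qmat_psd A C hA).conjTranspose_mul_mul_same (mexp (-(x • A)) * mexp ((8 * t) • A ^ 3))
    convert this using 1
    have hc : Commute (mexp (-(x • A))) (mexp ((8 * t) • A ^ 3)) :=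
      mexp_comm _ _ ((((Commute.refl A).pow_right 3).smul_left x).neg_left.smul_right _)
    rw [hc.eq, Matrix.conjTranspose_eq_transpose_of_trivial, Matrix.transpose_mul, ← mexp_transpose,
      ← mexp_transpose, ← hc.eq]
    simp only [calQ, Matrix.transpose_neg, Matrix.transpose_smul, Matrix.transpose_pow,
      Matrix.mul_assoc]
  · have := (Nmat_psd A B hA).mul_mul_conjTranspose_same (mexp (-(x • A)))
    convert this using 1
    rw [Matrix.conjTranspose_eq_transpose_of_trivial, ← mexp_transpose]
    simp only [calN, Matrix.transpose_neg, Matrix.transpose_smul]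

theorem hasDerivAt_mexp {p : ℕ} (A : Matrix (Fin p) (Fin p) ℝ) (x : ℝ) :
    HasDerivAt (fun ξ : ℝ => mexp (-(ξ • A))) (-(A * mexp (-(x • A)))) x := by
  have h := hasDerivAt_exp_smul_const' (𝕂 := ℝ) (-A) x
  simp only [smul_neg] at h
  simp only [mexp_eq]
  rwa [neg_mul] at h

theorem statement7_mat {p : ℕ} (A : Matrix (Fin p) (Fin p) ℝ)
    (B : Matrix (Fin p) (Fin 1) ℝ) (C : Matrix (Fin 1) (Fin p) ℝ)
    (hA : EigPos A) (x t : ℝ) :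
    HasDerivAt (fun ξ : ℝ => mexp (-(ξ • Aᵀ)) * (Gam A B C ξ t)⁻¹ * mexp (-(ξ • Aᵀ)))
      ((-2 : ℝ) • (mexp (-(x • Aᵀ)) * (Gam A B C x t)⁻¹
          * (Aᵀ - calQ A C x t * A * calN A B x) * (Gam A B C x t)⁻¹ * mexp (-(x • Aᵀ)))) x := by
  have hE := hasDerivAt_mexp Aᵀ x
  have hEA := hasDerivAt_mexp A x
  have hT : Commute A (mexp ((8 * t) • A ^ 3)) :=
    mexp_comm' _ _ (((Commute.refl A).pow_right 3).smul_right _)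
  have hEc : Commute A (mexp (-(x • A))) :=
    mexp_comm' _ _ ((Commute.refl A).smul_right x).neg_right
  have hEc' : Commute Aᵀ (mexp (-(x • Aᵀ))) :=
    mexp_comm' _ _ ((Commute.refl Aᵀ).smul_right x).neg_right
  have hQ : HasDerivAt (fun ξ => calQ A C ξ t) (-(Aᵀ * calQ A C x t) - calQ A C x t * A) x := by
    have h := ((((hE.mul_const (mexp ((8 * t) • Aᵀ ^ 3))).mul_const (Qmat A C)).mul hEA).mul_const
      (mexp ((8 * t) • A ^ 3)))
    refine h.congr_deriv ?_
    simp only [calQ]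
    rw [Matrix.mul_assoc _ _ A, ← hT.eq, hEc.eq]
    noncomm_ring
  have hN : HasDerivAt (fun ξ => calN A B ξ) (-(A * calN A B x) - calN A B x * Aᵀ) x := by
    have h := (hEA.mul_const (Nmat A B)).mul hE
    refine h.congr_deriv ?_
    simp only [calN]
    rw [hEc'.eq]
    noncomm_ring
  have hG : HasDerivAt (fun ξ => Gam A B C ξ t)
      (-(Aᵀ * (Gam A B C x t)) - Gam A B C x t * Aᵀ
        + (2 : ℝ) • (Aᵀ - calQ A C x t * A * calN A B x)) x := by
    have h := (hQ.mul hN).const_add (1 : Matrix (Fin p) (Fin p) ℝ)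
    refine h.congr_deriv ?_
    simp only [Gam, two_smul]
    noncomm_ring
  obtain ⟨u, hu⟩ := Gam_unit A B C hA x t
  have hI := (hu ▸ hasFDerivAt_ringInverse (𝕜 := ℝ) u :
    HasFDerivAt Ring.inverse _ (Gam A B C x t)).comp_hasDerivAt x hG
  have hinv : ((u⁻¹ : (Matrix (Fin p) (Fin p) ℝ)ˣ) : Matrix (Fin p) (Fin p) ℝ)
      = (Gam A B C x t)⁻¹ := by
    rw [← hu, Matrix.coe_units_inv]
  have hI' : HasDerivAt (fun ξ => (Gam A B C ξ t)⁻¹) (-((Gam A B C x t)⁻¹ *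
      (-(Aᵀ * (Gam A B C x t)) - Gam A B C x t * Aᵀ
        + (2 : ℝ) • (Aᵀ - calQ A C x t * A * calN A B x)) * (Gam A B C x t)⁻¹)) x := by
    simp only [Matrix.nonsing_inv_eq_ringInverse] at hinv ⊢
    refine hI.congr_deriv ?_
    simp [hinv]
  refine ((hE.mul hI').mul hE).congr_deriv ?_
  have g1 : Gam A B C x t * (Gam A B C x t)⁻¹ = 1 := by rw [← hinv, ← hu]; simp
  have g2 : (Gam A B C x t)⁻¹ * Gam A B C x t = 1 := by rw [← hinv, ← hu]; simp
  simp only [Pi.mul_apply]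
  generalize (Gam A B C x t)⁻¹ = I at *
  generalize Gam A B C x t = G at *
  generalize Aᵀ - calQ A C x t * A * calN A B x = K
  generalize hEE : mexp (-(x • Aᵀ)) = E at *
  have k : I * (-(Aᵀ * G) - G * Aᵀ + (2 : ℝ) • K) * I = -(I * Aᵀ) - Aᵀ * I + (2 : ℝ) • (I * K * I) := by
    have : I * (-(Aᵀ * G) - G * Aᵀ + (2 : ℝ) • K) * I =
      -(I * Aᵀ * (G * I)) - (I * G) * Aᵀ * I + (2 : ℝ) • (I * K * I) := by
      simp only [two_smul]; noncomm_ring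
    rw [this, g1, g2]; simp
  rw [k]
  have e2 : (-(Aᵀ * E) * I + E * -(-(I * Aᵀ) - Aᵀ * I + (2 : ℝ) • (I * K * I))) * E
      + E * I * -(Aᵀ * E) = -((Aᵀ * E) * I * E) + (E * Aᵀ) * I * E + (-2 : ℝ) • (E * I * K * I * E) := by
    simp only [neg_smul, two_smul]; noncomm_ring
  have e3 : -((Aᵀ * E) * I * E) + (E * Aᵀ) * I * E + (-2 : ℝ) • (E * I * K * I * E)
      = (-2 : ℝ) • (E * I * K * I * E) := by
    rw [hEc'.eq, neg_add_cancel, zero_add]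
  rw [← e3, ← e2]

theorem lin_deriv {p : ℕ} (L : Matrix (Fin p) (Fin p) ℝ →ₗ[ℝ] ℝ)
    (f : ℝ → Matrix (Fin p) (Fin p) ℝ) (f' : Matrix (Fin p) (Fin p) ℝ) (x : ℝ)
    (h : HasDerivAt f f' x) : HasDerivAt (fun ξ => L (f ξ)) (L f') x :=
  (LinearMap.toContinuousLinearMap L).hasFDerivAt.comp_hasDerivAt x h

theorem statement7_lin {p : ℕ} (A : Matrix (Fin p) (Fin p) ℝ)
    (B : Matrix (Fin p) (Fin 1) ℝ) (C : Matrix (Fin 1) (Fin p) ℝ)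
    (hA : EigPos A) (x t : ℝ) (L : Matrix (Fin p) (Fin p) ℝ →ₗ[ℝ] ℝ) :
    HasDerivAt (fun ξ : ℝ => L (mexp (-(ξ • Aᵀ)) * (Gam A B C ξ t)⁻¹ * mexp (-(ξ • Aᵀ))))
      (L ((-2 : ℝ) • (mexp (-(x • Aᵀ)) * (Gam A B C x t)⁻¹
          * (Aᵀ - calQ A C x t * A * calN A B x) * (Gam A B C x t)⁻¹ * mexp (-(x • Aᵀ))))) x :=
  lin_deriv L _ _ x (statement7_mat A B C hA x t)

end aux

theorem statement7 {p : ℕ} (hp : 0 < p) (A : Matrix (Fin p) (Fin p) ℝ)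
    (B : Matrix (Fin p) (Fin 1) ℝ) (C : Matrix (Fin 1) (Fin p) ℝ)
    (hA : EigPos A) (hobs : Observable A C) (hctrl : Controllable A B) :
    ∀ x t : ℝ,
      HasDerivAt
        (fun ξ : ℝ => -2 * ((Bᵀ * mexp (-(ξ • Aᵀ)) * (Gam A B C ξ t)⁻¹ * mexp (-(ξ • Aᵀ))
          * mexp ((8 * t) • Aᵀ ^ 3) * Cᵀ : Matrix (Fin 1) (Fin 1) ℝ) 0 0))
        (4 * ((Bᵀ * mexp (-(x • Aᵀ)) * (Gam A B C x t)⁻¹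
          * (Aᵀ - calQ A C x t * A * calN A B x) * (Gam A B C x t)⁻¹ * mexp (-(x • Aᵀ))
          * mexp ((8 * t) • Aᵀ ^ 3) * Cᵀ : Matrix (Fin 1) (Fin 1) ℝ) 0 0)) x := by
  intro x t
  let L : Matrix (Fin p) (Fin p) ℝ →ₗ[ℝ] ℝ :=
    { toFun := fun X => (Bᵀ * X * (mexp ((8 * t) • Aᵀ ^ 3) * Cᵀ) : Matrix (Fin 1) (Fin 1) ℝ) 0 0
      map_add' := fun X Y => by rw [Matrix.mul_add, Matrix.add_mul, Matrix.add_apply]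
      map_smul' := fun c X => by
        rw [Matrix.mul_smul, Matrix.smul_mul, Matrix.smul_apply, RingHom.id_apply] }
  have h := (statement7_lin A B C hA x t L).const_mul (-2)
  rw [map_smul] at h
  simp only [L, LinearMap.coe_mk, AddHom.coe_mk, Matrix.mul_assoc] at h
  simp only [Matrix.mul_assoc]
  refine h.congr_deriv ?_
  simp only [smul_eq_mul]
  ring
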